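/- Let G be an almost peripheral graph of order n ≥ 8 with maximum degree n − 4. Then the number of vertices of G having degree n − 4 is at most n − 5. -/

import Mathlib

open SimpleGraph

/-- The eccentricity of a vertex `v`: the maximum distance from `v` to any vertex. -/
noncomputable def graphEcc {V : Type*} [Fintype V] (G : SimpleGraph V) (v : V) : ℕ :=
  Finset.univ.sup fun u => G.dist v u

/-- The radius of a graph: the minimum eccentricity over all vertices. -/
noncomputable def graphRadius {V : Type*} [Fintype V] (G : SimpleGraph V) : ℕ :=
  sInf (Set.range (graphEcc G))

/-- The diameter of a graph: the maximum eccentricity over all vertices. -/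
noncomputable def graphDiam {V : Type*} [Fintype V] (G : SimpleGraph V) : ℕ :=
  Finset.univ.sup (graphEcc G)

/-- A connected graph of order `n` is almost self-centered if it has exactly `n - 2`
central vertices (vertices whose eccentricity equals the radius). -/
def IsAlmostSelfCentered {V : Type*} [Fintype V] (G : SimpleGraph V) : Prop :=
  G.Connected ∧ Nat.card {v : V | graphEcc G v = graphRadius G} = Fintype.card V - 2

/-- A connected graph of order `n` is almost peripheral if it has exactly `n - 1`
peripheral vertices (vertices whose eccentricity equals the diameter). -/
def IsAlmostPeripheral {V : Type*} [Fintype V] (G : SimpleGraph V) : Prop :=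
  G.Connected ∧ Nat.card {v : V | graphEcc G v = graphDiam G} = Fintype.card V - 1

/-- The maximum degree of a graph. -/
noncomputable def graphMaxDeg {V : Type*} [Fintype V] (G : SimpleGraph V) : ℕ :=
  Finset.univ.sup fun v => (G.neighborSet v).ncard

/-- `v` and `w` are at distance at least three. -/
def FarApart {V : Type*} (G : SimpleGraph V) (v w : V) : Prop :=
  v ≠ w ∧ ¬ G.Adj v w ∧ ∀ z, G.Adj v z → ¬ G.Adj z w

/-- `t` misses exactly the closed neighbourhood `{u, x, y}` of `u`. -/
def Patt {V : Type*} (G : SimpleGraph V) (t u x y : V) : Prop :=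
  FarApart G t u ∧ G.Adj u x ∧ G.Adj u y ∧ x ≠ y ∧
    ∀ v, v = t ∨ G.Adj t v ∨ v = u ∨ v = x ∨ v = y

/-- distance at most three -/
def Near3 {V : Type*} (G : SimpleGraph V) : Prop :=
  ∀ v w, v = w ∨ G.Adj v w ∨ (∃ z, G.Adj v z ∧ G.Adj z w) ∨
    ∃ z z', G.Adj v z ∧ G.Adj z z' ∧ G.Adj z' w

theorem ap_leaf {V : Type*} (G : SimpleGraph V) (c : V)
    (F1 : ∀ v, v ≠ c → ∃ w, FarApart G v w) (F3 : Near3 G)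
    (u x : V) (hux : G.Adj u x) (h : ∀ z, G.Adj u z → z = x) : x = c := by
  by_contra hx
  obtain ⟨w, h1, h2, h3⟩ := F1 x hx
  have hs := hux.symm
  rcases F3 u w with h' | h' | ⟨z, h', k2⟩ | ⟨z, z', h', k2, k3⟩
  · subst h'; exact h2 hs
  · exact h1 (h _ h').symm
  · have := h _ h'; subst this; exact h2 k2
  · have := h _ h'; subst this; exact h3 _ k2 k3

theorem ap_patt {V : Type*} (G : SimpleGraph V) (c : V)
    (F1 : ∀ v, v ≠ c → ∃ w, FarApart G v w) (F2 : ∀ w, ¬ FarApart G c w) (F3 : Near3 G)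
    (t a b e : V) (htc : t ≠ c) (hab : a ≠ b) (hae : a ≠ e) (hbe : b ≠ e)
    (hN : ∀ v, v = t ∨ G.Adj t v ∨ v = a ∨ v = b ∨ v = e) :
    ∃ u x y, Patt G t u x y := by
  have key : ∀ u x y, FarApart G t u → G.Adj u x → x ≠ y → u ≠ y →
      (∀ v, v = t ∨ G.Adj t v ∨ v = u ∨ v = x ∨ v = y) → Patt G t u x y := by
    intro u x z hf hux hxz huz hN
    refine ⟨hf, hux, ?_, hxz, hN⟩
    by_contra hnz
    obtain ⟨f1, f2, f3⟩ := hf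
    have hsym : ∀ v w, G.Adj v w → G.Adj w v := fun v w h => h.symm
    have hirr : ∀ v, ¬ G.Adj v v := fun v => G.irrefl
    have hleaf : ∀ w, G.Adj u w → w = x := by
      intro w hw
      rcases hN w with h | h | h | h | h
      · subst h; exact absurd hw.symm f2
      · exact absurd hw.symm (f3 _ h)
      · subst h; exact absurd hw (hirr _)
      · exact h
      · subst h; exact absurd hw hnz
    have hxc := ap_leaf G c F1 F3 u x hux hleaf
    subst hxc
    -- common neighbour of x and t
    have hxt : ¬ G.Adj x t := fun h => f3 _ h.symm (hux.symm)
    have hcom : ∀ v, v ≠ x → ¬ G.Adj x v → ∃ w, G.Adj x w ∧ G.Adj w v := by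
      intro v h1 h2
      by_contra h3
      push Not at h3
      exact F2 v ⟨h1.symm, h2, h3⟩
    -- every w adjacent to x and t is far from z
    have hw : ∀ w, G.Adj x w → G.Adj w t → FarApart G w z := by
      intro w h1 h2
      obtain ⟨w', g1, g2, g3⟩ := F1 w (h1.ne')
      rcases hN w' with h | h | h | h | h
      · subst h; exact absurd h2 g2
      · exact absurd h (g3 _ h2)
      · subst h; exact absurd hux.symm (g3 _ h1.symm)
      · subst h; exact absurd h1.symm g2
      · subst h; exact ⟨g1, g2, g3⟩
    obtain ⟨w, w1, w2⟩ := hcom t htc hxt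
    have hwz := hw w w1 w2
    have hxz' : ¬ G.Adj x z := fun h => hwz.2.2 _ w1.symm h
    obtain ⟨s, s1, s2⟩ := hcom z hxz.symm hxz'
    rcases hN s with h | h | h | h | h
    · subst h; exact hxt s1
    · exact (hw s s1 h.symm).2.1 s2
    · subst h; exact hnz s2
    · subst h; exact hirr _ s1
    · subst h; exact hirr _ s2
  have key2 : ∀ u x y, FarApart G t u → x ≠ y → u ≠ x → u ≠ y →
      (∀ v, v = t ∨ G.Adj t v ∨ v = u ∨ v = x ∨ v = y) → ∃ u x y, Patt G t u x y := by
    intro u x y hf hxy hux huy hN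
    have : ∃ z, G.Adj u z := by
      rcases F3 u t with h | h | ⟨z, h, _⟩ | ⟨z, z', h, _⟩
      · exact absurd h.symm hf.1
      · exact ⟨_, h⟩
      · exact ⟨_, h⟩
      · exact ⟨_, h⟩
    obtain ⟨w, hw⟩ := this
    obtain ⟨f1, f2, f3⟩ := id hf
    rcases hN w with h | h | h | h | h
    · subst h; exact absurd hw.symm f2
    · exact absurd hw.symm (f3 _ h)
    · subst h; exact absurd hw G.irrefl
    · subst h; exact ⟨_, _, _, key u w y hf hw hxy huy hN⟩
    · subst h; exact ⟨_, _, _, key u w x hf hw hxy.symm hux (by grind)⟩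
  obtain ⟨u, hf⟩ := F1 t htc
  rcases hN u with h | h | h | h | h
  · exact absurd h.symm hf.1
  · exact absurd h hf.2.1
  · subst h; exact key2 u b e hf hbe hab hae hN
  · subst h; exact key2 u a e hf hae hab.symm hbe (by grind)
  · subst h; exact key2 u a b hf hab hae.symm hbe.symm (by grind)

theorem Patt.nb {V : Type*} {G : SimpleGraph V} {t u x y : V} (h : Patt G t u x y) :
    (∀ v, G.Adj u v ↔ v = x ∨ v = y) ∧ ¬ G.Adj t u ∧ ¬ G.Adj t x ∧ ¬ G.Adj t y ∧
      t ≠ u ∧ t ≠ x ∧ t ≠ y ∧ u ≠ x ∧ u ≠ y ∧ x ≠ y := by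
  obtain ⟨⟨f1, f2, f3⟩, h1, h2, h3, h4⟩ := h
  have hsym : ∀ v w, G.Adj v w → G.Adj w v := fun v w h => h.symm
  have hirr : ∀ v, ¬ G.Adj v v := fun v => G.irrefl
  refine ⟨fun v => ⟨fun hv => ?_, by grind⟩, f2, fun h => f3 _ h h1.symm,
    fun h => f3 _ h h2.symm, f1, ?_, ?_, h1.ne, h2.ne, h3⟩
  · grind
  · rintro rfl; exact f2 h1.symm
  · rintro rfl; exact f2 h2.symm

/-- far partner of a neighbour of `t` -/
theorem Patt.partner {V : Type*} {G : SimpleGraph V} {t u x y c : V} (h : Patt G t u x y)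
    (F1 : ∀ v, v ≠ c → ∃ w, FarApart G v w) (v : V) (hv : v ≠ c) (htv : G.Adj t v) :
    FarApart G v u ∨ FarApart G v x ∨ FarApart G v y := by
  obtain ⟨w, hw⟩ := F1 v hv
  obtain ⟨g1, g2, g3⟩ := id hw
  rcases h.2.2.2.2 w with h | h | h | h | h
  · subst h; exact absurd htv.symm g2
  · exact absurd h (g3 _ htv.symm)
  · subst h; exact Or.inl hw
  · subst h; exact Or.inr (Or.inl hw)
  · subst h; exact Or.inr (Or.inr hw)

/-- adjacent `u1 = x2`, `u2 = x1`. -/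
theorem ap_adj {V : Type*} (G : SimpleGraph V) (c : V)
    (F1 : ∀ v, v ≠ c → ∃ w, FarApart G v w) (F2 : ∀ w, ¬ FarApart G c w)
    (t1 t2 u1 u2 y1 y2 : V) (h1 : Patt G t1 u1 u2 y1) (h2 : Patt G t2 u2 u1 y2)
    (ht1 : t1 ≠ c) (ht2 : t2 ≠ c) : y1 = y2 := by
  by_contra hy
  have hsym : ∀ v w, G.Adj v w → G.Adj w v := fun v w h => h.symm
  have hirr : ∀ v, ¬ G.Adj v v := fun v => G.irrefl
  obtain ⟨n1, a1, a2, a3, a4, a5, a6⟩ := h1.nb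
  obtain ⟨n2, b1, b2, b3, b4, b5, b6⟩ := h2.nb
  have e1 : G.Adj t1 y2 := by
    have := h1.2.2.2.2 y2
    grind
  have e2 : G.Adj t2 y1 := by
    have := h2.2.2.2.2 y1
    grind
  have p1 := h1.partner F1 y2
  have p2 := h2.partner F1 y1
  have q1 := F2 u1
  have q2 := F2 u2
  have q3 := F2 t1
  have q4 := F2 y1
  have q5 := F2 y2
  have r1 := h1.1
  have r2 := h2.1
  by_cases hc1 : y1 = c
  · subst hc1
    have := p1 (Ne.symm hy) e1
    simp only [FarApart] at *
    grind
  by_cases hc2 : y2 = c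
  · subst hc2
    have := p2 hy e2
    simp only [FarApart] at *
    grind
  have hcom : ∀ v, v = c ∨ G.Adj c v ∨ ∃ w, G.Adj c w ∧ G.Adj w v := by
    intro v
    by_contra hcon
    push Not at hcon
    exact F2 v ⟨hcon.1.symm, hcon.2.1, hcon.2.2⟩
  have c1 : u1 ≠ c := by
    rintro rfl
    exact F2 t1 ⟨h1.1.1.symm, fun h => h1.1.2.1 h.symm, fun z a b => h1.1.2.2 z b.symm a.symm⟩
  have c2 : u2 ≠ c := by
    rintro rfl
    exact F2 t2 ⟨h2.1.1.symm, fun h => h2.1.2.1 h.symm, fun z a b => h2.1.2.2 z b.symm a.symm⟩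
  have k1 : G.Adj c y1 := by
    have := hcom u1
    grind
  have k2 : G.Adj c y2 := by
    have := hcom u2
    grind
  rcases p2 hc1 e2 with g | g | g
  · exact g.2.2 u1 (h1.2.2.1.symm) h1.2.1
  · exact g.2.1 (h1.2.2.1.symm)
  · exact g.2.2 c k1.symm k2

theorem ap_small {V : Type*} [Fintype V] [DecidableEq V] (h8 : 8 ≤ Fintype.card V)
    (a b d e f g h : V) :
    ∃ v, v ≠ a ∧ v ≠ b ∧ v ≠ d ∧ v ≠ e ∧ v ≠ f ∧ v ≠ g ∧ v ≠ h := by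
  by_contra hcon
  have : ({a, b, d, e, f, g, h} : Finset V) = Finset.univ := by
    rw [Finset.eq_univ_iff_forall]
    intro v
    simp only [Finset.mem_insert, Finset.mem_singleton]
    by_contra h'
    push Not at h'
    exact hcon ⟨v, h'⟩
  have h1 := (Finset.card_insert_le a ({b, d, e, f, g, h} : Finset V))
  have h2 := @Finset.card_le_six V _ b d e f g h
  rw [this, Finset.card_univ] at h1
  omega

theorem ap_tu {V : Type*} [Fintype V] (G : SimpleGraph V) (h8 : 8 ≤ Fintype.card V)
    (t1 t2 u1 u2 x1 y1 x2 y2 : V)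
    (h1 : Patt G t1 u1 x1 y1) (h2 : Patt G t2 u2 x2 y2) : t1 ≠ u2 := by
  classical
  rintro rfl
  obtain ⟨v, hv⟩ := ap_small h8 t1 u1 x1 y1 x2 y2 y2
  have := h2.nb.1 v
  have := h1.2.2.2.2 v
  grind

theorem ap_nonadj_main {V : Type*} [Fintype V] (G : SimpleGraph V) (c : V)
    (F1 : ∀ v, v ≠ c → ∃ w, FarApart G v w) (F2 : ∀ w, ¬ FarApart G c w)
    (h8 : 8 ≤ Fintype.card V)
    (t1 t2 t3 u1 u2 y1 y2 u3 x3 y3 : V)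
    (h1 : Patt G t1 u1 t2 y1) (h2 : Patt G t2 u2 t1 y2) (h3 : Patt G t3 u3 x3 y3)
    (ht1 : t1 ≠ c) (ht2 : t2 ≠ c) (ht3 : t3 ≠ c) (h31 : t3 ≠ t1) (h32 : t3 ≠ t2)
    (hu : u1 ≠ u2) (hna : ¬ G.Adj u1 u2) : False := by
  classical
  have hsym : ∀ v w, G.Adj v w → G.Adj w v := fun v w h => h.symm
  have hirr : ∀ v, ¬ G.Adj v v := fun v => G.irrefl
  have n1 := h1.nb
  have n2 := h2.nb
  by_cases hy : y1 = y2
  · subst hy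
    have hO : ∀ v, v ≠ c → v ≠ t1 → v ≠ t2 → v ≠ u1 → v ≠ u2 → v ≠ y1 → FarApart G v y1 := by
      intro v g0 g1 g2 g3 g4 g5
      have a1 := h1.2.2.2.2 v
      have a2 := h2.2.2.2.2 v
      have b1 : G.Adj t1 v := by grind
      have b2 : G.Adj t2 v := by grind
      rcases h1.partner F1 v g0 b1 with k | k | k
      · exact absurd h1.2.1.symm (k.2.2 _ b2.symm)
      · exact absurd b2.symm k.2.1
      · exact k
    have hcom : ∀ v, v = c ∨ G.Adj c v ∨ ∃ w, G.Adj c w ∧ G.Adj w v := by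
      intro v
      by_contra hcon
      push Not at hcon
      exact F2 v ⟨hcon.1.symm, hcon.2.1, hcon.2.2⟩
    have hyc : y1 ≠ c := by
      rintro rfl
      obtain ⟨v, hv⟩ := ap_small h8 y1 t1 t2 u1 u2 u2 u2
      have g := hO v hv.1 hv.2.1 hv.2.2.1 hv.2.2.2.1 hv.2.2.2.2.1 hv.1
      exact F2 v ⟨g.1.symm, fun k => g.2.1 k.symm, fun k k1 k2 => g.2.2 k k2.symm k1.symm⟩
    have c1 : u1 ≠ c := by
      rintro rfl
      exact F2 t1 ⟨h1.1.1.symm, fun h => h1.1.2.1 h.symm, fun z a b => h1.1.2.2 z b.symm a.symm⟩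
    have c2 : u2 ≠ c := by
      rintro rfl
      exact F2 t2 ⟨h2.1.1.symm, fun h => h2.1.2.1 h.symm, fun z a b => h2.1.2.2 z b.symm a.symm⟩
    have hyadj : G.Adj y1 c := by
      rcases hcom y1 with g | g | ⟨z, z1, z2⟩
      · exact absurd g hyc
      · exact g.symm
      · exfalso
        have nz : ¬ FarApart G z y1 := fun h => h.2.1 z2
        have i1 : z ≠ c := z1.ne'
        have i2 : z ≠ t1 := by rintro rfl; exact n1.2.2.2.1 z2
        have i3 : z ≠ t2 := by rintro rfl; exact n2.2.2.2.1 z2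
        have i4 : z ≠ u1 := by
          rintro rfl
          rcases (n1.1 c).1 z1.symm with k | k
          · exact ht2 k.symm
          · exact hyc k.symm
        have i5 : z ≠ u2 := by
          rintro rfl
          rcases (n2.1 c).1 z1.symm with k | k
          · exact ht1 k.symm
          · exact hyc k.symm
        exact nz (hO z i1 i2 i3 i4 i5 z2.ne)
    have g2 : t3 ≠ u1 := ap_tu G h8 _ _ _ _ _ _ _ _ h3 h1
    have g3 : t3 ≠ u2 := ap_tu G h8 _ _ _ _ _ _ _ _ h3 h2
    have g1 : t3 ≠ y1 := by
      rintro rfl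
      obtain ⟨v, v1, v2, v3, v4, v5, v6, -⟩ := ap_small h8 c t3 t1 t2 u1 u2 u2
      obtain ⟨v', w1, w2, w3, w4, w5, w6, w7⟩ := ap_small h8 c t3 t1 t2 u1 u2 v
      have m1 := (hO v v1 v3 v4 v5 v6 v2).2.1
      have m2 := (hO v' w1 w3 w4 w5 w6 w2).2.1
      have b1 := h3.2.2.2.2 v
      have b2 := h3.2.2.2.2 v'
      have b3 := h3.2.2.2.2 t1
      have b4 := h3.2.2.2.2 t2
      have b5 := n1.2.2.2.1
      have b6 := n2.2.2.2.1
      have b7 := n2.2.2.2.2.2.1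
      clear h1 h2 h3 n1 n2 F1 F2 hO hcom
      grind
    have hf3 := hO t3 ht3 h31 h32 g2 g3 g1
    have d3 : ¬ G.Adj t3 c := fun h => hf3.2.2 _ h hyadj.symm
    have d1 : ¬ G.Adj t3 u1 := fun h => hf3.2.2 _ h h1.2.2.1
    have d2 : ¬ G.Adj t3 u2 := fun h => hf3.2.2 _ h h2.2.2.1
    have d4 := hf3.2.1
    have b1 := h3.2.2.2.2 u1
    have b2 := h3.2.2.2.2 u2
    have b3 := h3.2.2.2.2 c
    have b4 := h3.2.2.2.2 y1
    have m1 : u1 ≠ y1 := h1.2.2.1.ne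
    have m2 : u2 ≠ y1 := h2.2.2.1.ne
    clear h1 h2 h3 n1 n2 F1 F2 hO hcom hf3
    grind
  · obtain ⟨v, v1, v2, v3, v4, v5, v6, v7⟩ := ap_small h8 c t1 t2 u1 u2 y1 y2
    have a1 := h1.2.2.2.2 v
    have a2 := h2.2.2.2.2 v
    have b1 : G.Adj t1 v := by grind
    have b2 : G.Adj t2 v := by grind
    have k1 : FarApart G v y1 := by
      rcases h1.partner F1 v v1 b1 with k | k | k
      · exact absurd h1.2.1.symm (k.2.2 _ b2.symm)
      · exact absurd b2.symm k.2.1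
      · exact k
    have hm : G.Adj t2 y1 := by
      have := h2.2.2.2.2 y1
      grind
    exact k1.2.2 _ b2.symm hm

theorem ap_nonadj {V : Type*} [Fintype V] (G : SimpleGraph V) (c : V)
    (F1 : ∀ v, v ≠ c → ∃ w, FarApart G v w) (F2 : ∀ w, ¬ FarApart G c w)
    (h8 : 8 ≤ Fintype.card V)
    (t1 t2 t3 u1 u2 x1 y1 x2 y2 u3 x3 y3 : V)
    (h1 : Patt G t1 u1 x1 y1) (h2 : Patt G t2 u2 x2 y2) (h3 : Patt G t3 u3 x3 y3)
    (ht1 : t1 ≠ c) (ht2 : t2 ≠ c) (ht3 : t3 ≠ c) (h31 : t3 ≠ t1) (h32 : t3 ≠ t2)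
    (hu : u1 ≠ u2) (hna : ¬ G.Adj u1 u2) : False := by
  classical
  have hsym : ∀ v w, G.Adj v w → G.Adj w v := fun v w h => h.symm
  have hirr : ∀ v, ¬ G.Adj v v := fun v => G.irrefl
  have n1 := h1.nb.1
  have n2 := h2.nb.1
  have e1 : G.Adj t1 u2 := by
    have := h1.2.2.2.2 u2
    have := ap_tu G h8 _ _ _ _ _ _ _ _ h1 h2
    grind
  have e2 : G.Adj t2 u1 := by
    have := h2.2.2.2.2 u1
    have := ap_tu G h8 _ _ _ _ _ _ _ _ h2 h1
    grind
  have s1 : ∃ y, Patt G t1 u1 t2 y := by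
    rcases (n1 t2).1 e2.symm with h | h
    · subst h; exact ⟨_, h1⟩
    · subst h; exact ⟨x1, h1.1, h1.2.2.1, h1.2.1, h1.2.2.2.1.symm, by grind [Patt]⟩
  have s2 : ∃ y, Patt G t2 u2 t1 y := by
    rcases (n2 t1).1 e1.symm with h | h
    · subst h; exact ⟨_, h2⟩
    · subst h; exact ⟨x2, h2.1, h2.2.2.1, h2.2.1, h2.2.2.2.1.symm, by grind [Patt]⟩
  obtain ⟨y, hy⟩ := s1
  obtain ⟨y', hy'⟩ := s2
  exact ap_nonadj_main G c F1 F2 h8 t1 t2 t3 u1 u2 y y' u3 x3 y3 hy hy' h3 ht1 ht2 ht3 h31 h32 hu hna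

/-- all tops in `T` miss the same set -/
theorem ap_same {V : Type*} (G : SimpleGraph V) (c : V)
    (F1 : ∀ v, v ≠ c → ∃ w, FarApart G v w) (F2 : ∀ w, ¬ FarApart G c w) (F3 : Near3 G)
    (T : Set V) (t u x y p q : V) (htT : t ∈ T) (hcT : c ∉ T)
    (hT : ∀ s ∈ T, Patt G s u x y)
    (hR : ∀ v, v ∈ T ∨ v = u ∨ v = x ∨ v = y ∨ v = p ∨ v = q) : False := by
  have hsym : ∀ v w, G.Adj v w → G.Adj w v := fun v w h => h.symm
  have hirr : ∀ v, ¬ G.Adj v v := fun v => G.irrefl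
  have hTnb := fun s hs => (hT s hs).nb
  have h := hT t htT
  obtain ⟨n1, a1, a2, a3, a4, a5, a6, -⟩ := hTnb t htT
  have hxy : x ≠ y := h.2.2.2.1
  have hux := h.2.1
  have huy := h.2.2.1
  have hcu : c ≠ u := by
    rintro rfl
    exact F2 t ⟨h.1.1.symm, fun g => h.1.2.1 g.symm, fun z a b => h.1.2.2 z b.symm a.symm⟩
  have hcom : ∀ v, v = c ∨ G.Adj c v ∨ ∃ w, G.Adj c w ∧ G.Adj w v := by
    intro v
    by_contra hcon
    push Not at hcon
    exact F2 v ⟨hcon.1.symm, hcon.2.1, hcon.2.2⟩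
  -- all outside vertices are adjacent to t
  have hout : ∀ v, v ≠ t → v ≠ u → v ≠ x → v ≠ y → G.Adj t v := by
    intro v; have := h.2.2.2.2 v; grind
  have hpart : ∀ v, v ≠ c → v ≠ t → v ≠ u → v ≠ x → v ≠ y →
      FarApart G v u ∨ FarApart G v x ∨ FarApart G v y :=
    fun v h0 h1 h2 h3 h4 => h.partner F1 v h0 (hout v h1 h2 h3 h4)
  -- case c ∈ {x, y}
  have caseA : ∀ x y, c = x → Patt G t u x y → (∀ s ∈ T, Patt G s u x y) →
      (∀ v, v ∈ T ∨ v = u ∨ v = x ∨ v = y ∨ v = p ∨ v = q) → False := by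
    clear hT hR hTnb hpart h n1 a2 a3 a5 a6 hout hux huy hxy
    intro x y hcx h hT hR
    subst hcx
    obtain ⟨n1, a1, a2, a3, a4, a5, a6, a7, a8, a9⟩ := h.nb
    have hTx : ∀ s ∈ T, ¬ G.Adj s c ∧ ¬ G.Adj s y ∧ ¬ G.Adj s u := fun s hs =>
      ⟨(hT s hs).nb.2.2.1, (hT s hs).nb.2.2.2.1, (hT s hs).nb.2.1⟩
    have hcx : G.Adj u c := h.2.1
    have hcy : G.Adj u y := h.2.2.1
    obtain ⟨w, w1, w2⟩ : ∃ w, G.Adj c w ∧ G.Adj w t := by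
      rcases hcom t with g | g | g
      · exact absurd g a5
      · exact absurd g.symm a2
      · exact g
    have hwy : FarApart G w y := by
      rcases h.partner F1 w w1.ne' w2.symm with g | g | g
      · exact absurd hcx.symm (g.2.2 _ w1.symm)
      · exact absurd w1.symm g.2.1
      · exact g
    have hyc : ¬ G.Adj c y := hwy.2.2 _ w1.symm
    obtain ⟨z, z1, z2⟩ : ∃ z, G.Adj y z ∧ z ≠ u := by
      by_contra hcon
      push Not at hcon
      exact hcu (ap_leaf G c F1 F3 y u hcy.symm hcon).symm
    have hzT : z ∉ T := fun hz => (hTx z hz).2.1 z1.symm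
    have hwT : w ∉ T := fun hz => (hTx w hz).1 w1.symm
    have hzw : z ≠ w := by
      rintro rfl; exact hwy.2.1 z1.symm
    have hzc : z ≠ c := by
      rintro rfl; exact hyc z1.symm
    have htz : G.Adj t z := by
      rcases h.2.2.2.2 z with g | g | g | g | g
      · subst g; exact absurd htT hzT
      · exact g
      · exact absurd g z2
      · exact absurd g hzc
      · subst g; exact absurd z1 (hirr _)
    rcases h.partner F1 z hzc htz with g | g | g
    · exact g.2.2 _ z1.symm hcy.symm
    · exact F2 z ⟨g.1.symm, fun k => g.2.1 k.symm, fun k k1 k2 => g.2.2 k k2.symm k1.symm⟩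
    · exact g.2.1 z1.symm
  have caseB : ∀ x y r, c ≠ x → c ≠ y → G.Adj c x → Patt G t u x y → (∀ s ∈ T, Patt G s u x y) →
      (∀ v, v ∈ T ∨ v = u ∨ v = x ∨ v = y ∨ v = c ∨ v = r) → False := by
    clear hT hR hTnb hpart h n1 a2 a3 a5 a6 hout hux huy hxy
    intro x y r hcx hcy hadj h hT hR
    have hTx : ∀ s ∈ T, ¬ G.Adj s x ∧ ¬ G.Adj s y ∧ ¬ G.Adj s u := fun s hs =>
      ⟨(hT s hs).nb.2.2.1, (hT s hs).nb.2.2.2.1, (hT s hs).nb.2.1⟩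
    have hux : G.Adj u x := h.2.1
    have huy : G.Adj u y := h.2.2.1
    have n1 := h.nb.1
    have hTc : ∀ s ∈ T, G.Adj s c := by
      intro s hs
      rcases (hT s hs).2.2.2.2 c with g | g | g | g | g
      · subst g; exact absurd hs hcT
      · exact g
      · exact absurd g hcu
      · exact absurd g hcx
      · exact absurd g hcy
    have far : ∀ x, G.Adj u x → (∀ y, G.Adj u y → ¬ FarApart G x y) → G.Adj c x → c ≠ x →
        FarApart G x r := by
      intro x' hux' huy' hadj hcx
      obtain ⟨w, hw⟩ := F1 x' hcx.symm
      rcases hR w with g | g | g | g | g | g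
      · exact absurd (hTc w g).symm (hw.2.2 _ hadj.symm)
      · subst g; exact absurd hux'.symm hw.2.1
      · subst g; exact absurd hw (huy' _ hux)
      · subst g; exact absurd hw (huy' _ huy)
      · subst g; exact absurd hadj.symm hw.2.1
      · subst g; exact hw
    have nofar : ∀ x y, G.Adj u x → G.Adj u y → ¬ FarApart G x y := by
      intro x y h1 h2 h3
      exact h3.2.2 u h1.symm h2
    have hxr := far x hux (fun y hy => nofar x y hux hy) hadj hcx
    have hrc : ¬ G.Adj c r := hxr.2.2 _ hadj.symm
    have hry : ¬ G.Adj y r := by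
      by_cases g : G.Adj c y
      · exact (far y huy (fun z hz => nofar y z huy hz) g hcy).2.1
      · rcases hcom y with k | k | ⟨k, k1, k2⟩
        · exact absurd k.symm hcy
        · exact absurd k g
        · rcases hR k with m | m | m | m | m | m
          · exact absurd k2 (hTx k m).2.1
          · subst m
            rcases (n1 c).1 k1.symm with m | m
            · exact absurd m hcx
            · exact absurd m hcy
          · subst m; exact hxr.2.2 _ k2
          · subst m; exact absurd k1 g
          · subst m; exact absurd k1 (hirr _)
          · subst m; exact absurd k1 hrc
    have hru : r ≠ u := by
      rintro rfl; exact hxr.2.1 hux.symm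
    have hnu : ¬ G.Adj r u := by
      intro k
      rcases (n1 r).1 k.symm with m | m
      · exact hxr.1 m.symm
      · subst m; exact hxr.2.2 _ hux.symm huy
    have hrn : ∀ z, G.Adj r z → z ∈ T := by
      intro z hz
      rcases hR z with m | m | m | m | m | m
      · exact m
      · subst m; exact absurd hz hnu
      · subst m; exact absurd hz.symm hxr.2.1
      · subst m; exact absurd hz.symm hry
      · subst m; exact absurd hz.symm hrc
      · subst m; exact absurd hz (hirr _)
    rcases F3 r u with k | k | ⟨z, k1, k2⟩ | ⟨z, z', k1, k2, k3⟩
    · exact hru k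
    · exact hnu k
    · exact (hTx z (hrn z k1)).2.2 k2
    · have := hTx z (hrn z k1)
      rcases (n1 z').1 k3.symm with m | m
      · subst m; exact this.1 k2
      · subst m; exact this.2.1 k2
  have hswap : ∀ s ∈ T, Patt G s u y x := fun s hs => by
    have := hT s hs
    exact ⟨this.1, this.2.2.1, this.2.1, this.2.2.2.1.symm, by grind [Patt]⟩
  by_cases c1 : c = x
  · exact caseA x y c1 h hT hR
  by_cases c2 : c = y
  · exact caseA y x c2 (hswap t htT) hswap (by grind)
  have : ∃ r, ∀ v, v ∈ T ∨ v = u ∨ v = x ∨ v = y ∨ v = c ∨ v = r := by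
    rcases hR c with h | h | h | h | h | h
    · exact absurd h hcT
    · exact absurd h hcu
    · exact absurd h c1
    · exact absurd h c2
    · exact ⟨q, by grind⟩
    · exact ⟨p, by grind⟩
  obtain ⟨r, hr⟩ := this
  have : G.Adj c x ∨ G.Adj c y := by
    have := hcom u
    grind
  rcases this with g | g
  · exact caseB x y r c1 c2 g h hT hr
  · exact caseB y x r c2 c1 g (hswap t htT) hswap (by grind)

theorem Patt.swap {V : Type*} {G : SimpleGraph V} {t u x y : V} (h : Patt G t u x y) :
    Patt G t u y x :=
  ⟨h.1, h.2.2.1, h.2.1, h.2.2.2.1.symm, by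
    have := h.2.2.2.2
    grind⟩

theorem Patt.turn {V : Type*} {G : SimpleGraph V} {s t u v y : V} (h : Patt G s v u y)
    (h' : Patt G t u v y) : Patt G s u v y := by
  have n1 := h.nb
  have n2 := h'.nb
  refine ⟨⟨n1.2.2.2.2.2.1, n1.2.2.1, fun z hz hzu => ?_⟩, h'.2.1, h'.2.2.1, h'.2.2.2.1, ?_⟩
  · rcases (n2.1 z).1 hzu.symm with g | g
    · subst g; exact n1.2.1 hz
    · subst g; exact n1.2.2.2.1 hz
  · have := h.2.2.2.2
    grind

theorem ap_core {V : Type*} [Fintype V] (G : SimpleGraph V) (c : V)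
    (F1 : ∀ v, v ≠ c → ∃ w, FarApart G v w) (F2 : ∀ w, ¬ FarApart G c w) (F3 : Near3 G)
    (h8 : 8 ≤ Fintype.card V) (T : Set V) (hcT : c ∉ T)
    (hT : ∀ t ∈ T, ∃ u x y, Patt G t u x y) (h3 : 3 ≤ T.ncard) (h5 : Tᶜ.ncard ≤ 5) : False := by
  classical
  have : Nonempty V := ⟨c⟩
  have hne : T.Nonempty := by
    apply Set.nonempty_of_ncard_ne_zero; omega
  have hcT' : ∀ s ∈ T, s ≠ c := fun s hs h => hcT (h ▸ hs)
  obtain ⟨t, ht⟩ := hne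
  obtain ⟨u, x, y, h⟩ := hT t ht
  by_cases hall : ∀ s ∈ T, Patt G s u x y
  · have hsub : ({u, x, y} : Set V) ⊆ Tᶜ := by
      intro v hv hvT
      have := (hall v hvT).nb
      simp only [Set.mem_insert_iff, Set.mem_singleton_iff] at hv
      grind
    have hc3 : ({u, x, y} : Set V).ncard = 3 := by
      rw [Set.ncard_eq_three]
      exact ⟨u, x, y, h.2.1.ne, h.2.2.1.ne, h.2.2.2.1, rfl⟩
    have hd := Set.ncard_sdiff_add_ncard_of_subset hsub
    have : ∃ p q, ∀ v ∈ Tᶜ \ {u, x, y}, v = p ∨ v = q := by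
      by_cases h1 : (Tᶜ \ {u, x, y}).ncard ≤ 1
      · rw [Set.ncard_le_one_iff_subset_singleton] at h1
        obtain ⟨p, hp⟩ := h1
        exact ⟨p, p, fun v hv => Or.inl (hp hv)⟩
      · have h2 : (Tᶜ \ {u, x, y}).ncard = 2 := by omega
        obtain ⟨p, q, -, hpq⟩ := Set.ncard_eq_two.1 h2
        refine ⟨p, q, fun v hv => ?_⟩
        rw [hpq] at hv
        simpa using hv
    obtain ⟨p, q, hpq⟩ := this
    refine ap_same G c F1 F2 F3 T t u x y p q ht hcT hall ?_
    intro v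
    have := hpq v
    simp only [Set.mem_sdiff, Set.mem_compl_iff, Set.mem_insert_iff, Set.mem_singleton_iff] at this
    grind
  · push Not at hall
    obtain ⟨s, hs, hns⟩ := hall
    obtain ⟨u', x', y', h'⟩ := hT s hs
    have hsym : ∀ v w, G.Adj v w → G.Adj w v := fun v w h => h.symm
    by_cases huu : u = u'
    · subst huu
      have n1 := h.nb
      have n2 := h'.nb
      have a1 := n1.1 x'
      have a2 := n1.1 y'
      have a3 := n2.1 x'
      have a4 := n2.1 y'
      have : (x' = x ∧ y' = y) ∨ (x' = y ∧ y' = x) := by grind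
      rcases this with ⟨rfl, rfl⟩ | ⟨rfl, rfl⟩
      · exact hns h'
      · exact hns h'.swap
    by_cases hadj : G.Adj u u'
    · have b1 : ∃ b, Patt G t u u' b ∧ (Patt G s u u' b → Patt G s u x y) := by
        rcases (h.nb.1 u').1 hadj with g | g
        · subst g; exact ⟨y, h, id⟩
        · subst g; exact ⟨x, h.swap, Patt.swap⟩
      have b2 : ∃ b, Patt G s u' u b := by
        rcases (h'.nb.1 u).1 hadj.symm with g | g
        · subst g; exact ⟨y', h'⟩
        · subst g; exact ⟨x', h'.swap⟩
      obtain ⟨b, b1, b3⟩ := b1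
      obtain ⟨b', b2⟩ := b2
      have := ap_adj G c F1 F2 t s u u' b b' b1 b2 (hcT' t ht) (hcT' s hs)
      subst this
      exact hns (b3 (b2.turn b1))
    · have : ∃ r ∈ T, r ∉ ({t, s} : Set V) := by
        refine Set.exists_mem_notMem_of_ncard_lt_ncard ?_ (Set.toFinite _)
        have := Set.ncard_insert_le t ({s} : Set V)
        rw [Set.ncard_singleton] at this
        omega
      obtain ⟨r, hr, hr'⟩ := this
      simp only [Set.mem_insert_iff, Set.mem_singleton_iff, not_or] at hr'
      obtain ⟨u3, x3, y3, hp3⟩ := hT r hr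
      exact ap_nonadj G c F1 F2 h8 t s r u u' x y x' y' u3 x3 y3 h h' hp3 (hcT' t ht) (hcT' s hs)
        (hcT' r hr) hr'.1 hr'.2 huu hadj

theorem ap_step {V : Type*} (G : SimpleGraph V) (hG : G.Connected) (a w : V) (haw : a ≠ w) :
    ∃ z, G.Adj a z ∧ G.dist a w = G.dist z w + 1 := by
  obtain ⟨p, hp⟩ := hG.exists_walk_length_eq_dist a w
  cases p with
  | nil => exact absurd rfl haw
  | @cons _ z _ h p =>
    refine ⟨z, h, ?_⟩
    have h1 := SimpleGraph.dist_le p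
    have h2 : G.dist a w ≤ G.dist a z + G.dist z w := hG.dist_triangle
    have h3 : G.dist a z = 1 := SimpleGraph.dist_eq_one_iff_adj.2 h
    rw [SimpleGraph.Walk.length_cons] at hp
    omega

/-- the diameter is three -/
theorem ap_diam {V : Type*} (G : SimpleGraph V) (hG : G.Connected) (c t a b e : V) (d : ℕ)
    (hd : ∀ v w, G.dist v w ≤ d) (hecc : ∀ v, v ≠ c → ∃ w, G.dist v w = d) (htc : t ≠ c)
    (hN : ∀ v, v = t ∨ G.Adj t v ∨ v = a ∨ v = b ∨ v = e) : d ≤ 3 := by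
  by_contra hd4
  obtain ⟨w, hw⟩ := hecc t htc
  have hz : ∀ v, G.dist v v = 0 := fun v => SimpleGraph.dist_self
  have hone : ∀ v w, G.Adj v w → G.dist v w = 1 := fun v w h => SimpleGraph.dist_eq_one_iff_adj.2 h
  have hcm : ∀ v w, G.dist v w = G.dist w v := fun v w => SimpleGraph.dist_comm
  have htri : ∀ u v w, G.dist u w ≤ G.dist u v + G.dist v w := fun u v w => hG.dist_triangle
  -- vertices at every distance from t
  have hdesc : ∀ k, k ≤ d → ∃ v, G.dist v t = d - k := by
    intro k
    induction k with
    | zero => intro _; exact ⟨w, by rw [hcm, hw]; rfl⟩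
    | succ k ih =>
      intro hk
      obtain ⟨v, hv⟩ := ih (by omega)
      obtain ⟨z, _, hz'⟩ := ap_step G hG v t (by rintro rfl; rw [hz] at hv; omega)
      exact ⟨z, by omega⟩
  obtain ⟨u, hu⟩ := hdesc (d - 4) (by omega)
  have hu : G.dist u t = 4 := by omega
  obtain ⟨q, huq, hq⟩ := ap_step G hG u t (by rintro rfl; rw [hz] at hu; omega)
  obtain ⟨p, hqp, hp⟩ := ap_step G hG q t (by rintro rfl; rw [hz] at hq; omega)
  have hfour : ∀ v, v = t ∨ G.Adj t v ∨ v = u ∨ v = q ∨ v = p := by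
    have k : ∀ v, 2 ≤ G.dist v t → v = a ∨ v = b ∨ v = e := by
      intro v hv
      rcases hN v with g | g | g
      · subst g; rw [hz] at hv; omega
      · have := hone _ _ g.symm; omega
      · exact g
    have k1 := k u (by omega)
    have k2 := k q (by omega)
    have k3 := k p (by omega)
    have e1 : u ≠ q := huq.ne
    have e2 : q ≠ p := hqp.ne
    have e3 : u ≠ p := by rintro rfl; omega
    intro v
    have := hN v
    grind
  have hdle : ∀ v, v = u ∨ v = q ∨ v = p ∨ G.dist v t ≤ 1 := by
    intro v
    rcases hfour v with g | g | g | g | g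
    · subst g; rw [hz]; simp
    · rw [hone _ _ g.symm]; simp
    · exact Or.inl g
    · exact Or.inr (Or.inl g)
    · exact Or.inr (Or.inr (Or.inl g))
  have hnu : ∀ v, G.Adj u v → v = q := by
    intro v hv
    have h1 := hone _ _ hv
    have h2 := htri u v t
    rcases hdle v with g | g | g | g
    · subst g; exact absurd hv G.irrefl
    · exact g
    · subst g; omega
    · omega
  have hnq : ∀ v, G.Adj q v → v = u ∨ v = p := by
    intro v hv
    have h1 := hone _ _ hv
    have h2 := htri q v t
    rcases hdle v with g | g | g | g
    · exact Or.inl g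
    · subst g; exact absurd hv G.irrefl
    · exact Or.inr g
    · omega
  have s1 := hone _ _ huq
  have s2 := hone _ _ hqp
  by_cases hqc : q = c
  · have hpc : p ≠ c := by rintro rfl; exact hqp.ne hqc
    obtain ⟨w, hw⟩ := hecc p hpc
    have f1 := hd q w
    obtain ⟨z, hz1, hz2⟩ := ap_step G hG q w (by
      rintro rfl; rw [hcm] at hw; omega)
    rcases hnq z hz1 with g | g
    · subst g
      obtain ⟨z', hz1', hz2'⟩ := ap_step G hG z w (by
        rintro rfl
        have := htri p q z
        have := hcm p q
        have := hcm q z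
        omega)
      have := hnu z' hz1'
      subst this
      omega
    · subst g; omega
  · obtain ⟨w, hw⟩ := hecc q hqc
    have f1 := hd u w
    obtain ⟨z, hz1, hz2⟩ := ap_step G hG u w (by
      rintro rfl; rw [hcm] at hw; omega)
    have := hnu z hz1
    subst this
    omega

theorem top_vertices_le_of_almostPeripheral {V : Type*} [Fintype V]
    (G : SimpleGraph V) (n : ℕ) (hn : Fintype.card V = n) (h8 : 8 ≤ n)
    (hAP : IsAlmostPeripheral G) (hmax : graphMaxDeg G = n - 4) :
    Nat.card {v : V | (G.neighborSet v).ncard = n - 4} ≤ n - 5 := by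
  classical
  obtain ⟨hG, hcard⟩ := hAP
  rw [Nat.card_coe_set_eq] at hcard ⊢
  have hnc : Nat.card V = n := by rw [Nat.card_eq_fintype_card, hn]
  by_contra hcon
  set d := graphDiam G with hd_def
  have hle : ∀ v w, G.dist v w ≤ graphEcc G v := fun v w =>
    Finset.le_sup (f := fun u => G.dist v u) (Finset.mem_univ w)
  have hecd : ∀ v, graphEcc G v ≤ d := fun v => Finset.le_sup (f := graphEcc G) (Finset.mem_univ v)
  have hattain : ∀ v, ∃ w, G.dist v w = graphEcc G v := by
    intro v
    obtain ⟨w, -, hw⟩ := Finset.exists_mem_eq_sup Finset.univ ⟨v, Finset.mem_univ v⟩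
      (fun u => G.dist v u)
    exact ⟨w, hw.symm⟩
  have hd : ∀ v w, G.dist v w ≤ d := fun v w => (hle v w).trans (hecd v)
  have h1 : {v : V | graphEcc G v = d}ᶜ.ncard = 1 := by
    have := Set.ncard_add_ncard_compl {v : V | graphEcc G v = d}
    omega
  obtain ⟨c, hc⟩ := Set.ncard_eq_one.1 h1
  have hmem : ∀ v, graphEcc G v ≠ d ↔ v = c := by
    intro v
    have : v ∈ {v : V | graphEcc G v = d}ᶜ ↔ v ∈ ({c} : Set V) := by rw [hc]
    simpa using this
  have hcd : graphEcc G c < d := lt_of_le_of_ne (hecd c) ((hmem c).2 rfl)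
  have hecc : ∀ v, v ≠ c → ∃ w, G.dist v w = d := by
    intro v hv
    obtain ⟨w, hw⟩ := hattain v
    refine ⟨w, ?_⟩
    rw [hw]
    by_contra h
    exact hv ((hmem v).1 h)
  have hone : ∀ v w, G.Adj v w → G.dist v w = 1 := fun v w h => SimpleGraph.dist_eq_one_iff_adj.2 h
  have hd3 : 3 ≤ d := by
    by_contra hlt
    have hN : G.neighborSet c = {c}ᶜ := by
      ext v
      simp only [SimpleGraph.mem_neighborSet, Set.mem_compl_iff, Set.mem_singleton_iff]
      refine ⟨fun h => h.ne', fun h => ?_⟩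
      have h1 := hle c v
      have h2 := hG.pos_dist_of_ne (Ne.symm h)
      exact SimpleGraph.dist_eq_one_iff_adj.1 (by omega)
    have h2 : (G.neighborSet c).ncard ≤ graphMaxDeg G :=
      Finset.le_sup (f := fun v => (G.neighborSet v).ncard) (Finset.mem_univ c)
    have h3 := Set.ncard_add_ncard_compl ({c} : Set V)
    rw [Set.ncard_singleton] at h3
    rw [hN] at h2
    omega
  have hthree : ∀ t, (G.neighborSet t).ncard = n - 4 → ∃ a b e, a ≠ b ∧ a ≠ e ∧ b ≠ e ∧
      ∀ v, v = t ∨ G.Adj t v ∨ v = a ∨ v = b ∨ v = e := by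
    intro t ht
    have h2 := Set.ncard_insert_of_notMem (a := t) (s := G.neighborSet t) (by simp)
    have h3 := Set.ncard_add_ncard_compl (insert t (G.neighborSet t))
    obtain ⟨a, b, e, hab, hae, hbe, hs⟩ := Set.ncard_eq_three.1
      (show (insert t (G.neighborSet t))ᶜ.ncard = 3 by omega)
    refine ⟨a, b, e, hab, hae, hbe, fun v => ?_⟩
    have : v ∈ (insert t (G.neighborSet t))ᶜ ↔ v ∈ ({a, b, e} : Set V) := by rw [hs]
    simp only [Set.mem_compl_iff, Set.mem_insert_iff, SimpleGraph.mem_neighborSet,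
      Set.mem_singleton_iff] at this
    tauto
  set T : Set V := {v : V | (G.neighborSet v).ncard = n - 4} \ {c} with hT
  have hT1 : {v : V | (G.neighborSet v).ncard = n - 4}.ncard ≤ T.ncard + 1 := by
    have := Set.ncard_le_ncard_sdiff_add_ncard {v : V | (G.neighborSet v).ncard = n - 4} {c}
    rwa [Set.ncard_singleton] at this
  have hT2 := Set.ncard_add_ncard_compl T
  have hTne : T.Nonempty := by
    apply Set.nonempty_of_ncard_ne_zero; omega
  obtain ⟨t0, ht0⟩ := hTne
  obtain ⟨a, b, e, -, -, -, hN⟩ := hthree t0 ht0.1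
  have hdd := ap_diam G hG c t0 a b e d hd hecc ht0.2 hN
  have F1 : ∀ v, v ≠ c → ∃ w, FarApart G v w := by
    intro v hv
    obtain ⟨w, hw⟩ := hecc v hv
    refine ⟨w, ?_, ?_, ?_⟩
    · rintro rfl
      rw [SimpleGraph.dist_self] at hw
      omega
    · intro h
      have := hone _ _ h
      omega
    · intro z hz1 hz2
      have g1 := hone _ _ hz1
      have g2 := hone _ _ hz2
      have g3 : G.dist v w ≤ G.dist v z + G.dist z w := hG.dist_triangle
      omega
  have F2 : ∀ w, ¬ FarApart G c w := by
    rintro w ⟨g1, g2, g3⟩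
    have h0 := hle c w
    obtain ⟨z, z1, z2⟩ := ap_step G hG c w g1
    by_cases hzw : z = w
    · subst hzw; exact g2 z1
    obtain ⟨z', z1', z2'⟩ := ap_step G hG z w hzw
    have : z' = w := hG.dist_eq_zero_iff.1 (by omega)
    subst this
    exact g3 _ z1 z1'
  have F3 : Near3 G := by
    intro v w
    have h0 := hd v w
    by_cases g0 : v = w
    · exact Or.inl g0
    obtain ⟨z, z1, z2⟩ := ap_step G hG v w g0
    by_cases g1 : z = w
    · subst g1; exact Or.inr (Or.inl z1)
    obtain ⟨z', z1', z2'⟩ := ap_step G hG z w g1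
    by_cases g2 : z' = w
    · subst g2; exact Or.inr (Or.inr (Or.inl ⟨z, z1, z1'⟩))
    obtain ⟨z'', z1'', z2''⟩ := ap_step G hG z' w g2
    have : z'' = w := hG.dist_eq_zero_iff.1 (by omega)
    subst this
    exact Or.inr (Or.inr (Or.inr ⟨z, z', z1, z1', z1''⟩))
  refine ap_core G c F1 F2 F3 (by omega) T (fun h => h.2 rfl) ?_ (by omega) (by omega)
  intro t ht
  obtain ⟨a, b, e, hab, hae, hbe, hN⟩ := hthree t ht.1
  exact ap_patt G c F1 F2 F3 t a b e ht.2 hab hae hbe hN
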